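/- arXiv:2005.02685 — 3 statements merged into one kernel-verified Lean document; each statement's English description precedes it below -/
import Mathlib

section
/- For every integer m ≥ 0, ∑_{k=1}^∞ (ζ(2k+1) − 1)·L_{2k+m}/(2k+1) = (1 − γ)·L_m + (√5·F_{m−1}/2)·(ln(−π·sec(√5·π/2)) − 2·ln Γ(α) − 4·ln α), where α = (1+√5)/2, γ is the Euler–Mascheroni constant, Γ is the gamma function, and for m = 0 one sets F_{−1} = 1 (the standard extension to negative indices). -/
open Real

def lucas : ℕ → ℕ
  | 0 => 2
  | 1 => 1
  | n + 2 => lucas n + lucas (n + 1)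

def fibZ (n : ℤ) : ℤ :=
  if 0 ≤ n then (Nat.fib n.toNat : ℤ) else (-1) ^ (n.natAbs + 1) * (Nat.fib n.natAbs : ℤ)

def lucasZ (n : ℤ) : ℤ :=
  if 0 ≤ n then (lucas n.toNat : ℤ) else (-1) ^ n.natAbs * (lucas n.natAbs : ℤ)

/-- The logarithm series of `log ((1 + x) / (1 - x)) / 2` at `x = z / (n + 2)`, without its first term. -/
lemma hasSum_log_sub_log_tail {z : ℝ} (hz0 : 0 ≤ z) (hz2 : z < 2) (n : ℕ) :
    HasSum (fun k : ℕ => z ^ (2 * k + 3) / (2 * k + 3) * (1 / ((n : ℝ) + 2) ^ (2 * k + 3)))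
      ((log (2 + z + n) - log (2 - z + n)) / 2 - z / (n + 2)) := by
  have hn : (0 : ℝ) ≤ n := n.cast_nonneg
  have hx : |z / ((n : ℝ) + 2)| < 1 := by
    rw [abs_of_nonneg (by positivity), div_lt_one (by positivity)]
    linarith
  have h := (hasSum_nat_add_iff' 1).2 ((hasSum_log_sub_log_of_abs_lt_one hx).div_const 2)
  have h₁ : log (1 + z / ((n : ℝ) + 2)) = log (2 + z + n) - log (n + 2) := by
    rw [← log_div (by positivity) (by positivity)]
    congr 1
    field_simp
    ring
  have h₂ : log (1 - z / ((n : ℝ) + 2)) = log (2 - z + n) - log (n + 2) := by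
    rw [← log_div (by linarith) (by positivity)]
    congr 1
    field_simp
    ring
  convert! h using 1
  · ext k
    push_cast
    rw [div_pow, show 2 * (k + 1) + 1 = 2 * k + 3 by ring]
    field_simp
    ring
  · rw [h₁, h₂]
    simp

open Filter Topology in
/-- The sum over `n` is governed by Euler's limit formula for `log Γ` and by the definition of `γ`. -/
lemma hasSum_log_sub_log_sub_div {z : ℝ} (hz0 : 0 ≤ z) (hz2 : z < 2) :
    HasSum (fun n : ℕ => (log (2 + z + n) - log (2 - z + n)) / 2 - z / ((n : ℝ) + 2))
      ((1 - eulerMascheroniConstant) * z + (log (Gamma (2 - z)) - log (Gamma (2 + z))) / 2) := by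
  have hpos (n : ℕ) : 0 ≤ (log (2 + z + n) - log (2 - z + n)) / 2 - z / ((n : ℝ) + 2) :=
    (hasSum_log_sub_log_tail hz0 hz2 n).nonneg fun k => by positivity
  rw [hasSum_iff_tendsto_nat_of_nonneg hpos, ← tendsto_add_atTop_iff_nat 1]
  have hg₁ := BohrMollerup.tendsto_log_gamma (x := 2 - z) (by linarith)
  have hg₂ := BohrMollerup.tendsto_log_gamma (x := 2 + z) (by linarith)
  have h₁ : Tendsto (fun n : ℕ => 1 / ((n : ℝ) + 1)) atTop (𝓝 0) :=
    tendsto_one_div_add_atTop_nhds_zero_nat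
  have h₂ : Tendsto (fun n : ℕ => 1 / (((n + 1 : ℕ) : ℝ) + 1)) atTop (𝓝 0) :=
    (tendsto_add_atTop_iff_nat 1).2 h₁
  have h := ((hg₁.sub hg₂).div_const 2).sub
    ((((tendsto_harmonic_sub_log.add h₁).add h₂).sub_const 1).const_mul z)
  refine (h.congr fun n => ?_).trans_eq (by congr 1; ring)
  have hharm : ∑ i ∈ Finset.range (n + 1), z / ((i : ℝ) + 2)
      = z * ((harmonic n : ℝ) + 1 / ((n : ℝ) + 1) + 1 / (((n + 1 : ℕ) : ℝ) + 1) - 1) := by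
    induction n with
    | zero => simp; ring
    | succ n ih =>
      rw [Finset.sum_range_succ, ih, harmonic_succ]
      push_cast
      ring
  rw [Finset.sum_sub_distrib, ← Finset.sum_div, Finset.sum_sub_distrib, hharm]
  simp only [BohrMollerup.logGammaSeq]
  ring

/-- Generating function of `ζ(2k+3) - 1`, the latter written as a series. -/
lemma hasSum_zeta_tail_odd {z : ℝ} (hz0 : 0 ≤ z) (hz2 : z < 2) :
    HasSum (fun k : ℕ => z ^ (2 * k + 3) / (2 * k + 3) * ∑' n : ℕ, 1 / ((n : ℝ) + 2) ^ (2 * k + 3))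
      ((1 - eulerMascheroniConstant) * z + (log (Gamma (2 - z)) - log (Gamma (2 + z))) / 2) := by
  let f : ℕ × ℕ → ℝ := fun p =>
    z ^ (2 * p.2 + 3) / (2 * p.2 + 3) * (1 / ((p.1 : ℝ) + 2) ^ (2 * p.2 + 3))
  have hrow (n : ℕ) := hasSum_log_sub_log_tail hz0 hz2 n
  have hsum := hasSum_log_sub_log_sub_div hz0 hz2
  have hf : Summable f := by
    refine (summable_prod_of_nonneg fun p => ?_).2 ⟨fun n => (hrow n).summable, ?_⟩
    · simp only [f, Pi.zero_apply]
      positivity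
    · simpa only [f, (hrow _).tsum_eq] using hsum.summable
  have htot : HasSum f _ := hf.hasSum
  rw [(htot.prod_fiberwise hrow).unique hsum] at htot
  have hswap := (Equiv.prodComm ℕ ℕ).hasSum_iff.2 htot
  refine hswap.prod_fiberwise fun k => ?_
  have := (hswap.summable.prod_factor k).hasSum
  simpa only [f, Function.comp_apply, Equiv.prodComm_apply, Prod.swap_prod_mk, tsum_mul_left]
    using this

lemma riemannZeta_nat_sub_one {s : ℕ} (hs : 1 < s) :
    riemannZeta s - 1 = ((∑' n : ℕ, 1 / ((n : ℝ) + 2) ^ s : ℝ) : ℂ) := by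
  have hsum : Summable fun n : ℕ => 1 / (n : ℂ) ^ s := by
    simpa using Complex.summable_ofReal.2 (Real.summable_one_div_nat_pow.2 hs)
  rw [zeta_nat_eq_tsum_of_gt_one hs, ← hsum.sum_add_tsum_nat_add 2, Complex.ofReal_tsum]
  have : s ≠ 0 := by lia
  simp [Finset.sum_range_succ, this]

open scoped goldenRatio

lemma coe_lucas_eq (n : ℕ) : (lucas n : ℝ) = φ ^ n + ψ ^ n := by
  induction n using Nat.twoStepInduction with
  | zero => norm_num [lucas]
  | one => simp [lucas]
  | more n ih₁ ih₂ =>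
    rw [lucas, Nat.cast_add, ih₁, ih₂, pow_add φ n 2, pow_add ψ n 2, goldenRatio_sq, goldenConj_sq]
    ring

lemma sqrt_five_mul_fibZ_sub_one (m : ℕ) :
    √5 * (fibZ ((m : ℤ) - 1) : ℝ) = φ ^ m * (-ψ) + ψ ^ m * φ := by
  cases m with
  | zero =>
    have : fibZ (((0 : ℕ) : ℤ) - 1) = 1 := by decide
    rw [this]
    push_cast
    linear_combination -goldenRatio_sub_goldenConj
  | succ m =>
    have : fibZ (((m + 1 : ℕ) : ℤ) - 1) = Nat.fib m := by simp [fibZ]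
    rw [this, Int.cast_natCast, coe_fib_eq, mul_div_cancel₀ _ (by positivity)]
    linear_combination (ψ ^ m - φ ^ m) * (-goldenRatio_mul_goldenConj)

lemma coe_lucas_two_mul_add_eq (m k : ℕ) :
    (lucas (2 * k + m + 2) : ℝ)
      = φ ^ m * (-ψ) * φ ^ (2 * k + 3) + ψ ^ m * φ * (-ψ) ^ (2 * k + 3) := by
  rw [coe_lucas_eq, Odd.neg_pow ⟨k + 1, by ring⟩]
  linear_combination (φ ^ (2 * k + m + 2) + ψ ^ (2 * k + m + 2)) * goldenRatio_mul_goldenConj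

lemma log_Gamma_two_sub_goldenRatio :
    log (Gamma (2 - φ)) = log (-π / cos (√5 * π / 2)) - log (Gamma φ) - log φ := by
  have hφ := goldenRatio_pos
  have hG := Gamma_pos_of_pos hφ
  have hG' := Gamma_pos_of_pos (sub_pos.2 goldenRatio_lt_two)
  have hsin : sin (π * φ) = cos (√5 * π / 2) := by
    rw [← sin_add_pi_div_two]
    congr 1
    rw [goldenRatio]
    ring
  have hrec : Gamma (2 - φ) = ψ * Gamma (1 - φ) := by
    rw [one_sub_goldenConj, ← Gamma_add_one goldenConj_ne_zero]
    congr 1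
    linear_combination -goldenRatio_add_goldenConj
  have hprod : -π / cos (√5 * π / 2) = Gamma φ * Gamma (2 - φ) * φ := by
    rw [neg_div, ← hsin, ← Gamma_mul_Gamma_one_sub, hrec]
    linear_combination (-Gamma φ * Gamma (1 - φ)) * goldenRatio_mul_goldenConj
  rw [hprod, log_mul (by positivity) hφ.ne', log_mul hG.ne' hG'.ne']
  ring

lemma log_Gamma_two_add_goldenRatio : log (Gamma (2 + φ)) = log (Gamma φ) + 3 * log φ := by
  have hφ := goldenRatio_pos
  have hG := Gamma_pos_of_pos hφ
  have : Gamma (2 + φ) = φ ^ 3 * Gamma φ := by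
    rw [show 2 + φ = φ + 1 + 1 by ring, Gamma_add_one (by positivity), Gamma_add_one hφ.ne',
      ← goldenRatio_sq]
    ring
  rw [this, log_mul (by positivity) hG.ne', log_pow]
  push_cast
  ring

lemma log_Gamma_two_sub_goldenConj : log (Gamma (2 - ψ)) = log (Gamma φ) + log φ := by
  have hφ := goldenRatio_pos
  rw [show 2 - ψ = φ + 1 by linear_combination -goldenRatio_add_goldenConj, Gamma_add_one hφ.ne',
    log_mul hφ.ne' (Gamma_pos_of_pos hφ).ne']
  ring

lemma log_Gamma_two_add_goldenConj :
    log (Gamma (2 + ψ)) = log (Gamma (2 - φ)) - 2 * log φ := by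
  have h : 0 < 2 - φ := sub_pos.2 goldenRatio_lt_two
  have hsq : 2 - φ = (φ ^ 2)⁻¹ := by
    rw [← inv_pow, inv_goldenRatio, neg_sq, goldenConj_sq]
    linear_combination -goldenRatio_add_goldenConj
  have hlog : log (2 - φ) = -(2 * log φ) := by
    rw [hsq, log_inv, log_pow]
    push_cast
    ring
  rw [show 2 + ψ = 2 - φ + 1 by linear_combination goldenRatio_add_goldenConj,
    Gamma_add_one h.ne', log_mul h.ne' (Gamma_pos_of_pos h).ne', hlog]
  ring

theorem stmt17 (m : ℕ) :
    ∑' k : ℕ, (riemannZeta (2 * (k + 1) + 1) - 1) * (lucas (2 * k + m + 2) : ℂ) /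
        (2 * (k + 1) + 1 : ℂ) =
      (((1 - Real.eulerMascheroniConstant) * (lucas m : ℝ)
        + Real.sqrt 5 * (fibZ ((m : ℤ) - 1) : ℝ) / 2 *
          (Real.log (-π / Real.cos (Real.sqrt 5 * π / 2))
            - 2 * Real.log (Real.Gamma ((1 + Real.sqrt 5) / 2))
            - 4 * Real.log ((1 + Real.sqrt 5) / 2)) : ℝ) : ℂ) := by
  have hφ := hasSum_zeta_tail_odd goldenRatio_pos.le goldenRatio_lt_two
  have hψ := hasSum_zeta_tail_odd (z := -ψ) (by linarith [goldenConj_neg])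
    (by linarith [neg_one_lt_goldenConj])
  have h := (hφ.mul_left (φ ^ m * (-ψ))).add (hψ.mul_left (ψ ^ m * φ))
  refine HasSum.tsum_eq ?_
  convert! Complex.hasSum_ofReal.2 h using 1
  · ext k
    have hz := riemannZeta_nat_sub_one (s := 2 * k + 3) (by lia)
    have hl := congrArg (fun x : ℝ => (x : ℂ)) (coe_lucas_two_mul_add_eq m k)
    push_cast at hz hl ⊢
    rw [show (2 * (k + 1) + 1 : ℂ) = 2 * k + 3 by ring, hz, hl]
    ring
  · congr 1
    rw [sub_neg_eq_add, ← sub_eq_add_neg, log_Gamma_two_add_goldenConj,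
      log_Gamma_two_sub_goldenConj, log_Gamma_two_add_goldenRatio, log_Gamma_two_sub_goldenRatio,
      sqrt_five_mul_fibZ_sub_one, coe_lucas_eq]
    linear_combination (1 - eulerMascheroniConstant) * (φ ^ m + ψ ^ m) * goldenRatio_mul_goldenConj
end

section
/- The series ∑_{k=1}^∞ (ζ(2k+1) − 1)·L_{2k+1}/(2k+1) converges and equals 1 − γ, where γ is the Euler–Mascheroni constant. -/
open Real

open Filter Topology Finset

theorem coe_lucas_eq_goldenRatio_pow_add :
    ∀ n : ℕ, (lucas n : ℝ) = goldenRatio ^ n + goldenConj ^ n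
  | 0 => by norm_num [lucas]
  | 1 => by simp [lucas, goldenRatio_add_goldenConj]
  | n + 2 => by
    simp only [lucas, Nat.cast_add, coe_lucas_eq_goldenRatio_pow_add n,
      coe_lucas_eq_goldenRatio_pow_add (n + 1)]
    linear_combination -goldenRatio ^ n * goldenRatio_sq - goldenConj ^ n * goldenConj_sq

theorem hasSum_pow_odd_div_of_abs_lt_one {x : ℝ} (h : |x| < 1) :
    HasSum (fun k : ℕ => x ^ (2 * (k + 1) + 1) / (2 * (k + 1) + 1))
      ((log (1 + x) - log (1 - x)) / 2 - x) := by
  have H := ((hasSum_nat_add_iff' 1).2 (hasSum_log_sub_log_of_abs_lt_one h)).div_const 2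
  convert! H using 1
  · ext k
    push_cast
    ring
  · simp
    ring

theorem hasSum_lucas_odd_div {m : ℝ} (hm : 2 ≤ m) :
    HasSum (fun k : ℕ => (lucas (2 * (k + 1) + 1) : ℝ) / (2 * (k + 1) + 1) *
        (1 / m ^ (2 * (k + 1) + 1)))
      ((log (m ^ 2 + m - 1) - log ((m - 1) ^ 2 + (m - 1) - 1)) / 2 - 1 / m) := by
  have hm0 : 0 < m := by linarith
  have h1 := one_lt_goldenRatio
  have h2 := goldenRatio_lt_two
  have h3 := goldenConj_neg
  have h4 := neg_one_lt_goldenConj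
  have hs := goldenRatio_add_goldenConj
  have hp := goldenRatio_mul_goldenConj
  have hx : |goldenRatio / m| < 1 := by
    rw [abs_div, abs_of_pos hm0, div_lt_one hm0, abs_lt]
    constructor <;> linarith
  have hy : |goldenConj / m| < 1 := by
    rw [abs_div, abs_of_pos hm0, div_lt_one hm0, abs_lt]
    constructor <;> linarith
  have H := (hasSum_pow_odd_div_of_abs_lt_one hx).add (hasSum_pow_odd_div_of_abs_lt_one hy)
  convert! H using 1
  · ext k
    rw [coe_lucas_eq_goldenRatio_pow_add]
    generalize goldenRatio = a
    generalize goldenConj = b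
    ring
  · clear H
    generalize goldenRatio = a at *
    generalize goldenConj = b at *
    obtain ⟨hx1, hx2⟩ := abs_lt.1 hx
    obtain ⟨hy1, hy2⟩ := abs_lt.1 hy
    have e1 : m ^ 2 + m - 1 = m ^ 2 * ((1 + a / m) * (1 + b / m)) := by
      field_simp
      linear_combination -m * hs - hp
    have e2 : (m - 1) ^ 2 + (m - 1) - 1 =
        m ^ 2 * ((1 - a / m) * (1 - b / m)) := by
      field_simp
      linear_combination m * hs - hp
    have e3 : 1 / m = a / m + b / m := by
      rw [← add_div, hs]
    rw [e1, e2, e3, log_mul (by positivity) (by nlinarith), log_mul (by linarith) (by linarith),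
      log_mul (by positivity) (by nlinarith), log_mul (by linarith) (by linarith)]
    ring

theorem tendsto_log_quadratic_sub_harmonic :
    Tendsto (fun n : ℕ => log (((n + 1 : ℕ) : ℝ) ^ 2 + ((n + 1 : ℕ) : ℝ) - 1) / 2 -
      (harmonic (n + 1) : ℝ)) atTop (𝓝 (-eulerMascheroniConstant)) := by
  have h1 := (tendsto_harmonic_sub_log.comp (tendsto_add_atTop_nat 1)).neg
  have h0 := tendsto_one_div_add_atTop_nhds_zero_nat (𝕜 := ℝ)
  have h2 : Tendsto (fun n : ℕ => log (1 + 1 / ((n : ℝ) + 1) - (1 / ((n : ℝ) + 1)) ^ 2) / 2)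
      atTop (𝓝 0) := by
    have h3 : Tendsto (fun n : ℕ => 1 + 1 / ((n : ℝ) + 1) - (1 / ((n : ℝ) + 1)) ^ 2)
        atTop (𝓝 1) := by
      simpa using (h0.const_add 1).sub (h0.pow 2)
    simpa using (h3.log one_ne_zero).div_const 2
  have h := h1.add h2
  rw [add_zero] at h
  refine h.congr fun n => ?_
  have hn : (0 : ℝ) < n + 1 := by positivity
  have e : ((n : ℝ) + 1) ^ 2 + (n + 1) - 1 =
      ((n : ℝ) + 1) ^ 2 * (1 + 1 / ((n : ℝ) + 1) - (1 / ((n : ℝ) + 1)) ^ 2) := by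
    field_simp
  have hpos : 0 < ((n : ℝ) + 1) ^ 2 + (n + 1) - 1 := by
    have : (0 : ℝ) ≤ n := n.cast_nonneg
    nlinarith
  have hpos' : 0 < 1 + 1 / ((n : ℝ) + 1) - (1 / ((n : ℝ) + 1)) ^ 2 :=
    pos_of_mul_pos_right (e ▸ hpos) (by positivity)
  simp only [Function.comp_apply, Nat.cast_add, Nat.cast_one]
  rw [e, log_mul (by positivity) hpos'.ne', log_pow]
  push_cast
  ring

theorem sum_range_log_quadratic_sub (n : ℕ) :
    ∑ m ∈ range n, ((log (((m : ℝ) + 2) ^ 2 + (m + 2) - 1) -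
        log (((m : ℝ) + 2 - 1) ^ 2 + (m + 2 - 1) - 1)) / 2 - 1 / ((m : ℝ) + 2)) =
      log (((n + 1 : ℕ) : ℝ) ^ 2 + ((n + 1 : ℕ) : ℝ) - 1) / 2 - (harmonic (n + 1) : ℝ) + 1 := by
  induction n with
  | zero => norm_num
  | succ n ih =>
    rw [sum_range_succ, ih, harmonic_succ (n + 1)]
    have e : (n : ℝ) + 2 - 1 = n + 1 := by ring
    have e' : (n : ℝ) + 1 + 1 = n + 2 := by ring
    push_cast
    rw [e, e', one_div]
    ring

theorem riemannZeta_natCast_sub_one {n : ℕ} (hn : 1 < n) :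
    riemannZeta n - 1 = ((∑' m : ℕ, 1 / ((m : ℝ) + 2) ^ n : ℝ) : ℂ) := by
  have hs : Summable fun m : ℕ => 1 / (m : ℝ) ^ n := summable_one_div_nat_pow.2 hn
  have h : riemannZeta n = ((∑' m : ℕ, 1 / (m : ℝ) ^ n : ℝ) : ℂ) := by
    rw [zeta_nat_eq_tsum_of_gt_one hn]
    push_cast
    rfl
  rw [h, ← hs.sum_add_tsum_nat_add 2]
  simp [sum_range_succ, (by lia : n ≠ 0)]

theorem hasSum_zeta_sub_one_mul_lucas_odd :
    HasSum (fun k : ℕ => (lucas (2 * (k + 1) + 1) : ℝ) / (2 * (k + 1) + 1) *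
      ∑' m : ℕ, 1 / ((m : ℝ) + 2) ^ (2 * (k + 1) + 1)) (1 - eulerMascheroniConstant) := by
  let f : ℕ × ℕ → ℝ := fun p => (lucas (2 * (p.2 + 1) + 1) : ℝ) / (2 * (p.2 + 1) + 1) *
    (1 / ((p.1 : ℝ) + 2) ^ (2 * (p.2 + 1) + 1))
  have hf : 0 ≤ f := fun p => by
    simp only [f, Pi.zero_apply]
    positivity
  have hrow (m : ℕ) := hasSum_lucas_odd_div (m := (m : ℝ) + 2)
    (by linarith [m.cast_nonneg (α := ℝ)])
  have hrows := (hasSum_iff_tendsto_nat_of_nonneg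
    (fun m => (hrow m).nonneg fun k => hf (m, k)) (1 - eulerMascheroniConstant)).2 (by
      simp only [sum_range_log_quadratic_sub]
      simpa [add_comm, sub_eq_add_neg] using tendsto_log_quadratic_sub_harmonic.add_const 1)
  have hsum : Summable f := (summable_prod_of_nonneg hf).2
    ⟨fun m => (hrow m).summable, hrows.summable.congr fun m => (hrow m).tsum_eq.symm⟩
  have htot : HasSum f (1 - eulerMascheroniConstant) := by
    rw [← (hsum.hasSum.prod_fiberwise hrow).unique hrows]
    exact hsum.hasSum
  have hswap := (Equiv.prodComm ℕ ℕ).hasSum_iff.2 htot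
  convert! hswap.prod_fiberwise fun k => (hswap.summable.prod_factor k).hasSum using 1
  ext k
  exact tsum_mul_left.symm

theorem stmt18 :
    Summable (fun k : ℕ =>
      (riemannZeta (2 * (k + 1) + 1) - 1) * (lucas (2 * (k + 1) + 1) : ℂ) / (2 * (k + 1) + 1 : ℂ)) ∧
    ∑' k : ℕ, (riemannZeta (2 * (k + 1) + 1) - 1) * (lucas (2 * (k + 1) + 1) : ℂ) /
        (2 * (k + 1) + 1 : ℂ) =
      ((1 - Real.eulerMascheroniConstant : ℝ) : ℂ) := by
  have H : HasSum (fun k : ℕ =>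
      (riemannZeta (2 * (k + 1) + 1) - 1) * (lucas (2 * (k + 1) + 1) : ℂ) /
        (2 * (k + 1) + 1 : ℂ)) ((1 - Real.eulerMascheroniConstant : ℝ) : ℂ) := by
    convert! Complex.hasSum_ofReal.2 hasSum_zeta_sub_one_mul_lucas_odd using 1
    ext k
    have h := riemannZeta_natCast_sub_one (n := 2 * (k + 1) + 1) (by lia)
    rw [Complex.ofReal_mul, ← h]
    push_cast
    ring
  exact ⟨H.summable, H.tsum_eq⟩
end

section
/- For every integer m ≥ 0, ∑_{k=2}^∞ (ζ(k) − 1)·F_{k+m−1}/k = (1 − γ)·F_m − (ln Γ(α)/√5)·L_{m−1} + F_{m−1}·ln α + (α^{m−1}/√5)·ln(−(π/α²)·sec(√5·π/2)), where α = (1+√5)/2, γ is the Euler–Mascheroni constant, Γ is the gamma function, and for m = 0 one sets F_{−1} = 1 and L_{−1} = −1 (the standard extensions to negative indices). -/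
open Real

lemma lucas_eq_goldenRatio_pow_add (n : ℕ) :
    (lucas n : ℝ) = goldenRatio ^ n + goldenConj ^ n := by
  induction n using Nat.twoStepInduction with
  | zero => norm_num [lucas]
  | one => rw [lucas, pow_one, pow_one, goldenRatio_add_goldenConj, Nat.cast_one]
  | more n h₁ h₂ =>
    rw [lucas, Nat.cast_add, h₁, h₂]
    linear_combination -goldenRatio ^ n * goldenRatio_sq - goldenConj ^ n * goldenConj_sq

lemma fibZ_natCast_sub_one (m : ℕ) :
    (fibZ ((m : ℤ) - 1) : ℝ) =
      (goldenRatio ^ ((m : ℤ) - 1) - goldenConj ^ ((m : ℤ) - 1)) / √5 := by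
  cases m with
  | zero =>
    have h : √5 ≠ 0 := by positivity
    simp only [fibZ, Nat.cast_zero, zero_sub, zpow_neg_one, inv_goldenRatio, inv_goldenConj]
    rw [neg_sub_neg, goldenRatio_sub_goldenConj, div_self h]
    norm_num
  | succ n =>
    simp only [fibZ, Nat.cast_succ, add_sub_cancel_right, zpow_natCast]
    simp [coe_fib_eq]

lemma lucasZ_natCast_sub_one (m : ℕ) :
    (lucasZ ((m : ℤ) - 1) : ℝ) =
      goldenRatio ^ ((m : ℤ) - 1) + goldenConj ^ ((m : ℤ) - 1) := by
  cases m with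
  | zero =>
    simp only [lucasZ, Nat.cast_zero, zero_sub, zpow_neg_one, inv_goldenRatio, inv_goldenConj]
    rw [← neg_add, add_comm, goldenRatio_add_goldenConj]
    norm_num [lucas]
  | succ n =>
    simp only [lucasZ, Nat.cast_succ, add_sub_cancel_right, zpow_natCast]
    simp [lucas_eq_goldenRatio_pow_add]

lemma summable_one_div_nat_add_two_pow (k : ℕ) :
    Summable fun n : ℕ ↦ 1 / ((n : ℝ) + 2) ^ (k + 2) := by
  have h := (summable_nat_add_iff 2).mpr
    (Real.summable_one_div_nat_pow.mpr (by lia : 1 < k + 2))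
  simpa using h

lemma riemannZeta_sub_one_eq_tsum (k : ℕ) :
    riemannZeta (k + 2) - 1 = ((∑' n : ℕ, 1 / ((n : ℝ) + 2) ^ (k + 2) : ℝ) : ℂ) := by
  have h : riemannZeta (k + 2) = ((∑' n : ℕ, 1 / (n : ℝ) ^ (k + 2) : ℝ) : ℂ) := by
    have := zeta_nat_eq_tsum_of_gt_one (by lia : 1 < k + 2)
    push_cast at this ⊢
    exact this
  rw [h, ← (Real.summable_one_div_nat_pow.mpr (by lia : 1 < k + 2)).sum_add_tsum_nat_add 2]
  simp [Finset.sum_range_succ]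

lemma log_gammaSeq {s : ℝ} (hs : 0 < s) {N : ℕ} (hN : N ≠ 0) :
    Real.log (GammaSeq s N) = s * Real.log N + Real.log N.factorial
      - ∑ j ∈ Finset.range (N + 1), Real.log (s + j) := by
  have h (j : ℕ) : s + j ≠ 0 := by positivity
  have hN' : (0 : ℝ) < N := by positivity
  rw [GammaSeq, Real.log_div (by positivity) (Finset.prod_ne_zero_iff.mpr fun j _ ↦ h j),
    Real.log_mul (by positivity) (by positivity), Real.log_rpow hN',
    Real.log_prod fun j _ ↦ h j]

lemma sum_range_neg_log_sub_eq {x : ℝ} (hx : x < 2) {N : ℕ} (hN : N ≠ 0) :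
    ∑ n ∈ Finset.range (N + 1), (-Real.log (1 - x / (n + 2)) - x / (n + 2)) =
      Real.log (GammaSeq (2 - x) N) + (Real.log (N + 1) - Real.log N)
        + (Real.log (N + 2) - Real.log N) - x * (harmonic (N + 2) - Real.log N) + x := by
  rw [log_gammaSeq (by linarith) hN, Finset.sum_sub_distrib]
  have h₁ : ∑ n ∈ Finset.range (N + 1), x / ((n : ℝ) + 2) = x * (harmonic (N + 2) - 1) := by
    rw [harmonic, Finset.sum_range_succ' _ (N + 1), Rat.cast_add, Rat.cast_sum]
    simp only [div_eq_mul_inv, ← Finset.mul_sum]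
    push_cast
    norm_num [add_assoc]
  have h₂ (n : ℕ) : -Real.log (1 - x / (n + 2)) =
      Real.log (n + 2) - Real.log (2 - x + n) := by
    have hn : (0 : ℝ) < n + 2 := by positivity
    have hn' : 2 - x + (n : ℝ) ≠ 0 := by
      have : (0 : ℝ) ≤ n := n.cast_nonneg
      linarith
    rw [show 1 - x / ((n : ℝ) + 2) = (2 - x + n) / (n + 2) by field_simp; ring,
      Real.log_div hn' hn.ne']
    ring
  have h₃ (M : ℕ) : ∑ n ∈ Finset.range M, Real.log ((n : ℝ) + 2) =
      Real.log (M + 1).factorial := by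
    induction M with
    | zero => simp
    | succ M ih =>
      rw [Finset.sum_range_succ, ih, Nat.factorial_succ (M + 1), Nat.cast_mul,
        Real.log_mul (by positivity) (by positivity)]
      push_cast
      ring_nf
  have h₄ : Real.log (N + 1 + 1).factorial =
      Real.log (N + 2) + Real.log (N + 1) + Real.log N.factorial := by
    rw [Nat.factorial_succ, Nat.factorial_succ, Nat.cast_mul, Nat.cast_mul,
      Real.log_mul (by positivity) (by positivity), Real.log_mul (by positivity) (by positivity)]
    push_cast
    ring_nf
  simp only [h₂, Finset.sum_sub_distrib, h₁]
  rw [h₃ (N + 1), h₄]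
  ring

lemma tendsto_sum_neg_log_sub {x : ℝ} (hx : x < 2) :
    Filter.Tendsto
      (fun N : ℕ ↦ ∑ n ∈ Finset.range (N + 1), (-Real.log (1 - x / (n + 2)) - x / (n + 2)))
      Filter.atTop (nhds (Real.log (Real.Gamma (2 - x)) + (1 - eulerMascheroniConstant) * x)) := by
  have hG := (GammaSeq_tendsto_Gamma (2 - x)).log (Real.Gamma_pos_of_pos (by linarith)).ne'
  have h₁ := (tendsto_log_comp_add_sub_log 1).comp (tendsto_natCast_atTop_atTop (R := ℝ))
  have h₂ := (tendsto_log_comp_add_sub_log 2).comp (tendsto_natCast_atTop_atTop (R := ℝ))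
  have hγ : Filter.Tendsto (fun N : ℕ ↦ (harmonic (N + 2) : ℝ) - Real.log N) Filter.atTop
      (nhds eulerMascheroniConstant) := by
    have h := ((Filter.tendsto_add_atTop_iff_nat 2).mpr tendsto_harmonic_sub_log).add h₂
    simpa using h
  have h := (((hG.add h₁).add h₂).sub (hγ.const_mul x)).add_const x
  refine (h.congr' ?_).trans (le_of_eq (by ring_nf))
  filter_upwards [Filter.eventually_ne_atTop 0] with N hN
  simpa using (sum_range_neg_log_sub_eq hx hN).symm

lemma summable_div_pow_div {x : ℝ} (hx : |x| < 2) :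
    Summable fun p : ℕ × ℕ ↦ (x / (p.1 + 2)) ^ (p.2 + 2) / ((p.2 : ℝ) + 2) := by
  have h₁ : Summable fun n : ℕ ↦ x ^ 2 * (1 / ((n : ℝ) + 2) ^ (0 + 2)) :=
    (summable_one_div_nat_add_two_pow 0).mul_left _
  have h₂ : Summable fun k : ℕ ↦ (|x| / 2) ^ k :=
    summable_geometric_of_lt_one (by positivity) (by linarith)
  refine (h₁.mul_of_nonneg h₂ (fun n ↦ by positivity) (fun k ↦ by positivity)).of_norm_bounded ?_
  rintro ⟨n, k⟩
  have hn : (0 : ℝ) ≤ n := n.cast_nonneg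
  have hk : (0 : ℝ) ≤ k := k.cast_nonneg
  rw [Real.norm_eq_abs, abs_div, abs_pow, abs_div, abs_of_pos (by linarith : (0 : ℝ) < n + 2),
    abs_of_pos (by linarith : (0 : ℝ) < k + 2)]
  calc (|x| / (n + 2)) ^ (k + 2) / ((k : ℝ) + 2) ≤ (|x| / (n + 2)) ^ (k + 2) :=
        div_le_self (by positivity) (by linarith)
    _ = x ^ 2 * (1 / ((n : ℝ) + 2) ^ (0 + 2)) * (|x| / (n + 2)) ^ k := by
        rw [pow_add, mul_comm, div_pow, sq_abs]
        ring
    _ ≤ x ^ 2 * (1 / ((n : ℝ) + 2) ^ (0 + 2)) * (|x| / 2) ^ k := by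
        gcongr
        linarith

lemma hasSum_zeta_sub_one_mul_pow_div {x : ℝ} (hx : |x| < 2) :
    HasSum (fun k : ℕ ↦ (∑' n : ℕ, 1 / ((n : ℝ) + 2) ^ (k + 2)) * x ^ (k + 2) / (k + 2))
      (Real.log (Real.Gamma (2 - x)) + (1 - eulerMascheroniConstant) * x) := by
  have hS := summable_div_pow_div hx
  have hrow (n : ℕ) : HasSum (fun k : ℕ ↦ (x / ((n : ℝ) + 2)) ^ (k + 2) / ((k : ℝ) + 2))
      (-Real.log (1 - x / (n + 2)) - x / (n + 2)) := by
    have hn : (0 : ℝ) ≤ n := n.cast_nonneg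
    have hlt : |x / ((n : ℝ) + 2)| < 1 := by
      rw [abs_div, abs_of_pos (by linarith : (0 : ℝ) < n + 2), div_lt_one (by linarith)]
      linarith
    have h := (hasSum_nat_add_iff' 1).mpr (hasSum_pow_div_log_of_abs_lt_one hlt)
    simpa [add_assoc, one_add_one_eq_two] using h
  have hcol (k : ℕ) : HasSum (fun n : ℕ ↦ (x / ((n : ℝ) + 2)) ^ (k + 2) / ((k : ℝ) + 2))
      ((∑' n : ℕ, 1 / ((n : ℝ) + 2) ^ (k + 2)) * x ^ (k + 2) / (k + 2)) := by
    refine (((summable_one_div_nat_add_two_pow k).hasSum.mul_right (x ^ (k + 2))).div_const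
      ((k : ℝ) + 2)).congr_fun fun n ↦ ?_
    rw [div_pow]
    ring
  have htot := hS.hasSum.prod_fiberwise hrow
  have hlim := tendsto_nhds_unique
    ((Filter.tendsto_add_atTop_iff_nat 1).mpr htot.tendsto_sum_nat)
    (tendsto_sum_neg_log_sub (abs_lt.mp hx).2)
  rw [← hlim]
  exact ((Equiv.prodComm ℕ ℕ).hasSum_iff.mpr hS.hasSum).prod_fiberwise hcol

lemma cos_sqrt_five_mul_pi_div_two_neg : Real.cos (√5 * π / 2) < 0 := by
  have h₁ : 1 < √5 := by rw [Real.lt_sqrt] <;> norm_num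
  have h₂ : √5 < 3 := by rw [Real.sqrt_lt'] <;> norm_num
  apply Real.cos_neg_of_pi_div_two_lt_of_lt <;> nlinarith [Real.pi_pos]

lemma log_Gamma_two_sub_goldenRatio_s19 :
    Real.log (Real.Gamma (2 - goldenRatio)) =
      Real.log (-(π / goldenRatio ^ 2) / Real.cos (√5 * π / 2)) + Real.log goldenRatio
        - Real.log (Real.Gamma goldenRatio) := by
  have hφ := goldenRatio_pos
  have hG := Real.Gamma_pos_of_pos hφ
  have hcos := cos_sqrt_five_mul_pi_div_two_neg
  have hsin : Real.sin (π * goldenRatio) = Real.cos (√5 * π / 2) := by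
    rw [← Real.sin_add_pi_div_two]
    congr 1
    ring
  have hΓ := Real.Gamma_mul_Gamma_one_sub goldenRatio
  have hshift : Real.Gamma (2 - goldenRatio) = goldenConj * Real.Gamma goldenConj := by
    rw [← Real.Gamma_add_one goldenConj_ne_zero]
    congr 1
    linarith [goldenRatio_add_goldenConj]
  have hψ : goldenConj = -goldenRatio⁻¹ := by rw [inv_goldenRatio, neg_neg]
  rw [hsin, one_sub_goldenConj] at hΓ
  have hX : 0 < -(π / goldenRatio ^ 2) / Real.cos (√5 * π / 2) :=
    div_pos_of_neg_of_neg (neg_neg_of_pos (by positivity)) hcos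
  have key : Real.Gamma (2 - goldenRatio) =
      -(π / goldenRatio ^ 2) / Real.cos (√5 * π / 2) * goldenRatio / Real.Gamma goldenRatio := by
    rw [eq_div_iff hG.ne', hshift, mul_assoc, mul_comm (Real.Gamma goldenConj), hΓ]
    generalize Real.cos (√5 * π / 2) = c at *
    rw [hψ]
    generalize goldenRatio = a at *
    field_simp
  rw [key, Real.log_div (by positivity) hG.ne', Real.log_mul hX.ne' hφ.ne']

lemma log_Gamma_two_sub_goldenConj_s19 :
    Real.log (Real.Gamma (2 - goldenConj)) =
      Real.log goldenRatio + Real.log (Real.Gamma goldenRatio) := by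
  rw [show 2 - goldenConj = goldenRatio + 1 by linarith [goldenRatio_add_goldenConj],
    Real.Gamma_add_one goldenRatio_ne_zero,
    Real.log_mul goldenRatio_ne_zero (Real.Gamma_pos_of_pos goldenRatio_pos).ne']

theorem stmt19 (m : ℕ) :
    ∑' k : ℕ, (riemannZeta (k + 2) - 1) * (Nat.fib (k + m + 1) : ℂ) / (k + 2 : ℂ) =
      (((1 - Real.eulerMascheroniConstant) * (Nat.fib m : ℝ)
        - Real.log (Real.Gamma ((1 + Real.sqrt 5) / 2)) / Real.sqrt 5 * (lucasZ ((m : ℤ) - 1) : ℝ)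
        + (fibZ ((m : ℤ) - 1) : ℝ) * Real.log ((1 + Real.sqrt 5) / 2)
        + ((1 + Real.sqrt 5) / 2) ^ ((m : ℤ) - 1) / Real.sqrt 5 *
          Real.log (-(π / ((1 + Real.sqrt 5) / 2) ^ 2) / Real.cos (Real.sqrt 5 * π / 2)) : ℝ) : ℂ) := by
  have hφ : |goldenRatio| < 2 := by
    rw [abs_of_pos goldenRatio_pos]
    exact goldenRatio_lt_two
  have hψ : |goldenConj| < 2 :=
    abs_lt.mpr ⟨by linarith [neg_one_lt_goldenConj], by linarith [goldenConj_neg]⟩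
  have h := (((hasSum_zeta_sub_one_mul_pow_div hφ).mul_left (goldenRatio ^ ((m : ℤ) - 1))).sub
    ((hasSum_zeta_sub_one_mul_pow_div hψ).mul_left (goldenConj ^ ((m : ℤ) - 1)))).div_const √5
  have hpow {a : ℝ} (ha : a ≠ 0) (k : ℕ) :
      a ^ (k + m + 1) = a ^ ((m : ℤ) - 1) * a ^ (k + 2) := by
    rw [← zpow_natCast, ← zpow_natCast, ← zpow_add₀ ha]
    congr 1
    push_cast
    ring
  have hfib : (Nat.fib m : ℝ) = (goldenRatio ^ ((m : ℤ) - 1) * goldenRatio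
      - goldenConj ^ ((m : ℤ) - 1) * goldenConj) / √5 := by
    rw [← zpow_add_one₀ goldenRatio_ne_zero, ← zpow_add_one₀ goldenConj_ne_zero, sub_add_cancel,
      zpow_natCast, zpow_natCast, coe_fib_eq]
  rw [fibZ_natCast_sub_one, lucasZ_natCast_sub_one, hfib]
  rw [log_Gamma_two_sub_goldenRatio_s19, log_Gamma_two_sub_goldenConj_s19] at h
  refine HasSum.tsum_eq ?_
  convert Complex.hasSum_ofReal.mpr h using 1
  · ext k
    rw [riemannZeta_sub_one_eq_tsum, ← Complex.ofReal_natCast (Nat.fib _), coe_fib_eq,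
      hpow goldenRatio_ne_zero, hpow goldenConj_ne_zero]
    push_cast
    ring
  · congr 1
    change _ - _ / √5 * _ + _ * Real.log goldenRatio + goldenRatio ^ _ / √5 * _ = _
    ring
end
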